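/- Let W : ℝ² → ℝ be continuous with at most polynomial growth, and let a ≠ b be real numbers. If ∫_{ℝ²} e^{-(μ/2)(x₁²+x₂²)} e^{-(ν/2)(a x₁² + b x₂²)} W(x₁,x₂) dx₁ dx₂ = 0 for all (μ,ν) in a nonempty open subset of {(μ,ν) : μ + νa > 0, μ + νb > 0}, then W = 0 — provided in addition W(x₁,x₂) = g(x₁², x₂²) for some continuous g, in which case the hypothesis implies g = 0 (equivalently W = 0) by injectivity of the two-dimensional Laplace transform. -/

import Mathlib

open scoped Real
open MeasureTheory

lemma aux_complexMGF_eq {Ω : Type*} [MeasurableSpace Ω] (P Q : Measure Ω) (X : Ω → ℝ)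
    (hP : ∀ᶠ r in nhds (0 : ℝ), Integrable (fun x => Real.exp (r * X x)) P)
    (hQ : ∀ᶠ r in nhds (0 : ℝ), Integrable (fun x => Real.exp (r * X x)) Q)
    (h : ∀ᶠ r in nhds (0 : ℝ), ProbabilityTheory.mgf X P r = ProbabilityTheory.mgf X Q r) :
    ProbabilityTheory.complexMGF X P Complex.I = ProbabilityTheory.complexMGF X Q Complex.I := by
  obtain ⟨ε, hε, hb⟩ := Metric.eventually_nhds_iff_ball.1 (hP.and (hQ.and h))
  have hPs : Metric.ball (0 : ℝ) ε ⊆ interior (ProbabilityTheory.integrableExpSet X P) :=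
    interior_maximal (fun r hr => (hb r hr).1) Metric.isOpen_ball
  have hQs : Metric.ball (0 : ℝ) ε ⊆ interior (ProbabilityTheory.integrableExpSet X Q) :=
    interior_maximal (fun r hr => (hb r hr).2.1) Metric.isOpen_ball
  let S : Set ℂ := Complex.re ⁻¹' (Metric.ball (0 : ℝ) ε)
  have hS : IsPreconnected S :=
    ((convex_ball (0 : ℝ) ε).linear_preimage Complex.reLm).isPreconnected
  have aP : AnalyticOnNhd ℂ (ProbabilityTheory.complexMGF X P) S :=
    ProbabilityTheory.analyticOnNhd_complexMGF.mono (fun z hz => hPs hz)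
  have aQ : AnalyticOnNhd ℂ (ProbabilityTheory.complexMGF X Q) S :=
    ProbabilityTheory.analyticOnNhd_complexMGF.mono (fun z hz => hQs hz)
  have h0 : (0 : ℂ) ∈ S := by simpa [S] using hε
  have hI : Complex.I ∈ S := by simpa [S] using hε
  refine aP.eqOn_of_preconnected_of_frequently_eq aQ hS h0 ?_ hI
  have hfr : ∃ᶠ r : ℝ in nhdsWithin 0 {0}ᶜ, ProbabilityTheory.complexMGF X P (r : ℂ)
      = ProbabilityTheory.complexMGF X Q (r : ℂ) := by
    apply Filter.Eventually.frequently
    apply Filter.Eventually.filter_mono nhdsWithin_le_nhds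
    filter_upwards [h] with r hr
    rw [ProbabilityTheory.complexMGF_ofReal, ProbabilityTheory.complexMGF_ofReal, hr]
  have ht : Filter.Tendsto (fun r : ℝ => (r : ℂ)) (nhdsWithin 0 {0}ᶜ) (nhdsWithin 0 {0}ᶜ) := by
    apply tendsto_nhdsWithin_of_tendsto_nhds_of_eventually_within
    · exact (Complex.continuous_ofReal.tendsto' 0 0 (by simp)).mono_left nhdsWithin_le_nhds
    · filter_upwards [self_mem_nhdsWithin] with r hr
      simpa using hr
  exact ht.frequently hfr

lemma aux_integrable_one (c : ℝ) (hc : 0 < c) (m : ℕ) :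
    Integrable (fun x : ℝ => (1 + |x|) ^ m * Real.exp (-c * x ^ 2)) := by
  refine Integrable.mono' (((integrable_exp_neg_mul_sq (half_pos hc)).const_mul
    ((m.factorial : ℝ) * Real.exp (1 + 1 / (2 * c)))))
    (Continuous.aestronglyMeasurable (by fun_prop)) (Filter.Eventually.of_forall fun x => ?_)
  have h1 := Real.pow_div_factorial_le_exp (x := 1 + |x|) (by positivity) m
  rw [div_le_iff₀ (by positivity)] at h1
  rw [Real.norm_of_nonneg (by positivity)]
  have h2 : 1 + |x| + -c * x ^ 2 ≤ 1 + 1 / (2 * c) + -(c / 2) * x ^ 2 := by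
    have h3 : 1 / (2 * c) + c / 2 * x ^ 2 - |x| = c / 2 * (|x| - 1 / c) ^ 2 := by
      rw [← sq_abs x]; field_simp; ring
    have h4 : 0 ≤ c / 2 * (|x| - 1 / c) ^ 2 := by positivity
    linarith
  calc (1 + |x|) ^ m * Real.exp (-c * x ^ 2)
      ≤ Real.exp (1 + |x|) * m.factorial * Real.exp (-c * x ^ 2) := by gcongr
    _ = m.factorial * Real.exp (1 + |x| + -c * x ^ 2) := by
      rw [Real.exp_add (1 + |x|)]; ring
    _ ≤ m.factorial * Real.exp (1 + 1 / (2 * c) + -(c / 2) * x ^ 2) := by gcongr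
    _ = m.factorial * Real.exp (1 + 1 / (2 * c)) * Real.exp (-(c / 2) * x ^ 2) := by
      rw [Real.exp_add]; ring

lemma aux_integrable (W : ℝ × ℝ → ℝ) (hW : Continuous W)
    (hgrow : ∃ (C : ℝ) (m : ℕ), ∀ x : ℝ × ℝ, |W x| ≤ C * (1 + ‖x‖) ^ m)
    (a b : ℝ) (p : ℝ × ℝ) (h1 : 0 < p.1 + p.2 * a) (h2 : 0 < p.1 + p.2 * b) :
    Integrable (fun x : ℝ × ℝ =>
          Real.exp (-(p.1 / 2) * (x.1 ^ 2 + x.2 ^ 2)) *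
            Real.exp (-(p.2 / 2) * (a * x.1 ^ 2 + b * x.2 ^ 2)) * W x) := by
  obtain ⟨C, m, hC⟩ := hgrow
  have hC0 : 0 ≤ C := by
    have := (abs_nonneg _).trans (hC 0)
    simpa using this
  have hi := ((aux_integrable_one _ (half_pos h1) m).mul_prod
    (aux_integrable_one _ (half_pos h2) m)).const_mul C
  refine Integrable.mono' hi (Continuous.aestronglyMeasurable (by fun_prop))
    (Filter.Eventually.of_forall fun x => ?_)
  have hx : (1 + ‖x‖) ^ m ≤ (1 + |x.1|) ^ m * (1 + |x.2|) ^ m := by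
    rw [← mul_pow]
    apply pow_le_pow_left₀ (by positivity)
    rw [Prod.norm_def, Real.norm_eq_abs, Real.norm_eq_abs]
    have e1 := abs_nonneg x.1
    have e2 := abs_nonneg x.2
    rcases max_choice |x.1| |x.2| with h | h <;> rw [h] <;> nlinarith
  rw [norm_mul, Real.norm_of_nonneg (by positivity), Real.norm_eq_abs, ← Real.exp_add]
  have he : Real.exp (-(p.1 / 2) * (x.1 ^ 2 + x.2 ^ 2) +
      -(p.2 / 2) * (a * x.1 ^ 2 + b * x.2 ^ 2)) =
      Real.exp (-((p.1 + p.2 * a) / 2) * x.1 ^ 2) *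
        Real.exp (-((p.1 + p.2 * b) / 2) * x.2 ^ 2) := by
    rw [← Real.exp_add]; congr 1; ring
  rw [he]
  calc _ ≤ Real.exp (-((p.1 + p.2 * a) / 2) * x.1 ^ 2) *
        Real.exp (-((p.1 + p.2 * b) / 2) * x.2 ^ 2) *
        (C * ((1 + |x.1|) ^ m * (1 + |x.2|) ^ m)) := by
        gcongr
        exact (hC x).trans (by gcongr)
    _ = _ := by ring

lemma aux_nonpos (W : ℝ × ℝ → ℝ) (hW : Continuous W)
    (hgrow : ∃ (C : ℝ) (m : ℕ), ∀ x : ℝ × ℝ, |W x| ≤ C * (1 + ‖x‖) ^ m)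
    (a b : ℝ) (hab : a ≠ b)
    (g : ℝ × ℝ → ℝ) (hg : Continuous g)
    (hWg : ∀ x₁ x₂ : ℝ, W (x₁, x₂) = g (x₁ ^ 2, x₂ ^ 2))
    (U : Set (ℝ × ℝ)) (hU : IsOpen U) (hUne : U.Nonempty)
    (hUsub : U ⊆ {p : ℝ × ℝ | 0 < p.1 + p.2 * a ∧ 0 < p.1 + p.2 * b})
    (hvanish : ∀ p ∈ U,
      (∫ x : ℝ × ℝ,
          Real.exp (-(p.1 / 2) * (x.1 ^ 2 + x.2 ^ 2)) *
            Real.exp (-(p.2 / 2) * (a * x.1 ^ 2 + b * x.2 ^ 2)) * W x) = 0) :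
    ∀ x, W x ≤ 0 := by
  obtain ⟨q, hq⟩ := hUne
  let G : ℝ × ℝ → ℝ × ℝ → ℝ := fun p x => Real.exp (-(p.1 / 2) * (x.1 ^ 2 + x.2 ^ 2)) *
            Real.exp (-(p.2 / 2) * (a * x.1 ^ 2 + b * x.2 ^ 2))
  have hGpos : ∀ p x, 0 < G p x := fun p x => by positivity
  have hGc : ∀ p, Continuous (G p) := fun p => by fun_prop
  have hint : ∀ p ∈ U, Integrable (fun x => G p x * W x) := fun p hp =>
    aux_integrable W hW hgrow a b p (hUsub hp).1 (hUsub hp).2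
  have hv : ∀ p ∈ U, ∫ x, G p x * W x = 0 := hvanish
  let f : ℝ × ℝ → ℝ := fun x => G q x * W x
  have hfc : Continuous f := (hGc q).mul hW
  let P : Measure (ℝ × ℝ) := volume.withDensity fun x => ENNReal.ofReal (f x)
  let Q : Measure (ℝ × ℝ) := volume.withDensity fun x => ENNReal.ofReal (-f x)
  have : IsFiniteMeasure P := isFiniteMeasure_withDensity_ofReal (hint q hq).2
  have : IsFiniteMeasure Q := isFiniteMeasure_withDensity_ofReal (hint q hq).neg.2
  let Ψ : ℝ × ℝ → ℝ × ℝ := fun x =>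
    (-(1 / 2) * (x.1 ^ 2 + x.2 ^ 2), -(1 / 2) * (a * x.1 ^ 2 + b * x.2 ^ 2))
  have hΨ : Continuous Ψ := by fun_prop
  have hexp : ∀ (d : ℝ × ℝ) (r : ℝ) (x : ℝ × ℝ),
      Real.exp (r * (d.1 * (Ψ x).1 + d.2 * (Ψ x).2)) * G q x = G (q + r • d) x := by
    intro d r x
    simp only [G, Ψ, ← Real.exp_add, Prod.fst_add, Prod.snd_add, Prod.smul_fst, Prod.smul_snd,
      smul_eq_mul]
    congr 1; ring
  have hnear : ∀ d : ℝ × ℝ, ∀ᶠ r in nhds (0 : ℝ), q + r • d ∈ U := by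
    intro d
    have hc : Continuous fun r : ℝ => q + r • d := by fun_prop
    exact hc.continuousAt.eventually_mem (hU.mem_nhds (by simpa using hq))
  have hmP : Measurable fun x => ENNReal.ofReal (f x) := hfc.measurable.ennreal_ofReal
  have hmQ : Measurable fun x => ENNReal.ofReal (-f x) := hfc.measurable.neg.ennreal_ofReal
  have htP : ∀ᵐ x : ℝ × ℝ, ENNReal.ofReal (f x) < ⊤ :=
    Filter.Eventually.of_forall fun x => ENNReal.ofReal_lt_top
  have htQ : ∀ᵐ x : ℝ × ℝ, ENNReal.ofReal (-f x) < ⊤ :=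
    Filter.Eventually.of_forall fun x => ENNReal.ofReal_lt_top
  -- pointwise identities
  have hidP : ∀ (d : ℝ × ℝ) (r : ℝ) (x : ℝ × ℝ),
      (ENNReal.ofReal (f x)).toReal • Real.exp (r * (d.1 * (Ψ x).1 + d.2 * (Ψ x).2))
        = max (G (q + r • d) x * W x) 0 := by
    intro d r x
    rw [ENNReal.toReal_ofReal', smul_eq_mul, ← hexp, max_mul_of_nonneg _ _ (Real.exp_pos _).le]
    simp only [f, zero_mul]; congr 1; ring
  have hidQ : ∀ (d : ℝ × ℝ) (r : ℝ) (x : ℝ × ℝ),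
      (ENNReal.ofReal (-f x)).toReal • Real.exp (r * (d.1 * (Ψ x).1 + d.2 * (Ψ x).2))
        = max (-(G (q + r • d) x * W x)) 0 := by
    intro d r x
    rw [ENNReal.toReal_ofReal', smul_eq_mul, ← hexp, max_mul_of_nonneg _ _ (Real.exp_pos _).le]
    simp only [f, zero_mul]; congr 1; ring
  have key : P.map Ψ = Q.map Ψ := by
    apply Measure.ext_of_charFunDual
    funext L
    have hL : ∀ y : ℝ × ℝ, L y = L (1, 0) * y.1 + L (0, 1) * y.2 := by
      intro y
      have : y = y.1 • ((1 : ℝ), (0 : ℝ)) + y.2 • ((0 : ℝ), (1 : ℝ)) := by ext <;> simp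
      conv_lhs => rw [this]
      rw [map_add, map_smul, map_smul, smul_eq_mul, smul_eq_mul]; ring
    let d : ℝ × ℝ := (L (1, 0), L (0, 1))
    have hL' : ∀ x, L (Ψ x) = d.1 * (Ψ x).1 + d.2 * (Ψ x).2 := fun x => hL (Ψ x)
    have hm : Measurable Ψ := hΨ.measurable
    rw [charFunDual_apply, charFunDual_apply, integral_map hm.aemeasurable
      (Continuous.aestronglyMeasurable (by fun_prop)), integral_map hm.aemeasurable
      (Continuous.aestronglyMeasurable (by fun_prop))]
    have := aux_complexMGF_eq P Q (fun x => d.1 * (Ψ x).1 + d.2 * (Ψ x).2) ?_ ?_ ?_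
    · simpa only [ProbabilityTheory.complexMGF, hL', mul_comm Complex.I] using this
    · filter_upwards [hnear d] with r hr
      rw [integrable_withDensity_iff_integrable_smul' hmP htP]
      simp only [hidP]
      exact (hint _ hr).pos_part
    · filter_upwards [hnear d] with r hr
      rw [integrable_withDensity_iff_integrable_smul' hmQ htQ]
      simp only [hidQ]
      exact (hint _ hr).neg_part
    · filter_upwards [hnear d] with r hr
      rw [ProbabilityTheory.mgf, ProbabilityTheory.mgf,
        integral_withDensity_eq_integral_toReal_smul hmP htP,
        integral_withDensity_eq_integral_toReal_smul hmQ htQ]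
      simp only [hidP, hidQ]
      rw [← sub_eq_zero, ← integral_sub (hint _ hr).pos_part (hint _ hr).neg_part]
      refine Eq.trans ?_ (hv _ hr)
      congr 1
      funext x
      exact max_zero_sub_max_neg_zero_eq_self _
  let Θ : ℝ × ℝ → ℝ × ℝ := fun y =>
    ((-2 * y.2 + 2 * b * y.1) / (a - b), (-2 * y.2 + 2 * a * y.1) / (b - a))
  have hΘ : Continuous Θ := by fun_prop
  have hA : IsOpen {y | 0 < g (Θ y)} := isOpen_lt continuous_const (hg.comp hΘ)
  have hS : Ψ ⁻¹' {y | 0 < g (Θ y)} = {x | 0 < W x} := by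
    ext x
    have h1 : a - b ≠ 0 := sub_ne_zero.2 hab
    have h2 : b - a ≠ 0 := sub_ne_zero.2 hab.symm
    have : Θ (Ψ x) = (x.1 ^ 2, x.2 ^ 2) := by
      simp only [Θ, Ψ, Prod.mk.injEq]
      constructor
      · rw [div_eq_iff h1]; ring
      · rw [div_eq_iff h2]; ring
    simp only [Set.mem_preimage, Set.mem_ofPred_eq, this, ← hWg]
  have hPQ : P {x | 0 < W x} = Q {x | 0 < W x} := by
    rw [← hS, ← Measure.map_apply hΨ.measurable hA.measurableSet, key,
      Measure.map_apply hΨ.measurable hA.measurableSet]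
  have hSo : IsOpen {x | 0 < W x} := isOpen_lt continuous_const hW
  have hQ0 : Q {x | 0 < W x} = 0 := by
    rw [withDensity_apply_eq_zero hmQ]
    convert measure_empty (μ := (volume : Measure (ℝ × ℝ)))
    ext x
    simp only [Set.mem_inter_iff, Set.mem_ofPred_eq, Set.mem_empty_iff_false, iff_false, not_and,
      not_lt, ne_eq, ENNReal.ofReal_eq_zero, not_le]
    intro h
    by_contra! h'
    have := mul_pos (hGpos q x) h'
    simp only [f] at h
    linarith
  rw [hQ0, withDensity_apply_eq_zero hmP] at hPQ
  have : {x | ENNReal.ofReal (f x) ≠ 0} ∩ {x | 0 < W x} = {x | 0 < W x} := by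
    ext x
    simp only [Set.mem_inter_iff, Set.mem_ofPred_eq, ne_eq, ENNReal.ofReal_eq_zero, not_le,
      and_iff_right_iff_imp]
    exact fun h => mul_pos (hGpos q x) h
  rw [this, hSo.measure_eq_zero_iff (volume : Measure (ℝ × ℝ))] at hPQ
  intro x
  by_contra! h
  have : x ∈ {x | 0 < W x} := h
  rw [hPQ] at this
  exact this

/-- Injectivity of the two-dimensional Laplace transform, in the form used in the
paper: if `W : ℝ² → ℝ` is continuous of polynomial growth, of the form
`W(x₁,x₂) = g(x₁², x₂²)` with `g` continuous, `a ≠ b`, and the Gaussian–Laplace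
integrals `∫ e^{-(μ/2)(x₁²+x₂²)} e^{-(ν/2)(a x₁²+b x₂²)} W dx` vanish on a nonempty
open set of parameters `(μ,ν)` with `μ + νa > 0` and `μ + νb > 0`, then `W = 0`. -/
theorem laplace_transform_injectivity (W : ℝ × ℝ → ℝ) (hW : Continuous W)
    (hgrow : ∃ (C : ℝ) (m : ℕ), ∀ x : ℝ × ℝ, |W x| ≤ C * (1 + ‖x‖) ^ m)
    (a b : ℝ) (hab : a ≠ b)
    (g : ℝ × ℝ → ℝ) (hg : Continuous g)
    (hWg : ∀ x₁ x₂ : ℝ, W (x₁, x₂) = g (x₁ ^ 2, x₂ ^ 2))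
    (U : Set (ℝ × ℝ)) (hU : IsOpen U) (hUne : U.Nonempty)
    (hUsub : U ⊆ {p : ℝ × ℝ | 0 < p.1 + p.2 * a ∧ 0 < p.1 + p.2 * b})
    (hvanish : ∀ p ∈ U,
      (∫ x : ℝ × ℝ,
          Real.exp (-(p.1 / 2) * (x.1 ^ 2 + x.2 ^ 2)) *
            Real.exp (-(p.2 / 2) * (a * x.1 ^ 2 + b * x.2 ^ 2)) * W x) = 0) :
    W = 0 := by
  have h1 := aux_nonpos W hW hgrow a b hab g hg hWg U hU hUne hUsub hvanish
  have h2 := aux_nonpos (fun x => -W x) hW.neg (by simpa using hgrow) a b hab (fun x => -g x)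
    hg.neg (fun x₁ x₂ => by rw [hWg]) U hU hUne hUsub (fun p hp => by
      simp only [mul_neg, integral_neg, neg_eq_zero]
      exact hvanish p hp)
  funext x
  have h3 := h2 x
  exact le_antisymm (h1 x) (by simpa using h3)
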